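/- arXiv:2006.14534 — 2 statements merged into one kernel-verified Lean document; each statement's English description precedes it below -/
import Mathlib

section
/- Let n ≥ 3 be odd and set α = (n−1)/2. Let r be the unique root in (0,1) of the polynomial 1 − x − Σ_{i=1}^{α} 2x^{i+1}. Then the number of minimal strict shape 1 geodesics of length N satisfies lim_{N→∞} |O_n(N)|^{1/N} = 1/r. -/
open Filter Topology

abbrev Letter : Type := Fin 2 × Bool

def sigmaD (n : ℕ) (x : ℕ →₀ ℤ) : ℤ := x.sum fun i c => c * (n : ℤ) ^ i

def l1D (x : ℕ →₀ ℤ) : ℕ := x.sum fun _ c => c.natAbs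

def kIdx (x : ℕ →₀ ℤ) : ℕ := x.support.sup id

noncomputable def wVec (n i : ℕ) : ℕ →₀ ℤ := Finsupp.single i (-(n : ℤ)) + Finsupp.single (i + 1) 1

def etaLen (u w : ℕ) (x : ℕ →₀ ℤ) : ℕ :=
  if kIdx x ≤ w ∨ u ≤ w then
    u + l1D x + kIdx x + ((w : ℤ) - kIdx x).natAbs
  else
    ((kIdx x : ℤ) - u).natAbs + l1D x + kIdx x + w

def BoxSet (n u w : ℕ) (v : ℤ) : Set (ℕ →₀ ℤ) :=
  {x | sigmaD n x = v ∧
    (∀ i < kIdx x, |x i| ≤ ((n / 2 : ℕ) : ℤ)) ∧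
    (kIdx x < max u w → |x (kIdx x)| ≤ ((n / 2 : ℕ) : ℤ)) ∧
    (max u w ≤ kIdx x → |x (kIdx x)| ≤ ((n / 2 : ℕ) : ℤ) + if n = 2 then 2 else 1)}

def absLexLE (x y : ℕ →₀ ℤ) : Prop :=
  (∀ i, |x i| = |y i|) ∨ ∃ i : ℕ, (∀ j < i, |x j| = |y j|) ∧ |x i| < |y i|

def IsMinimalVec (n u w : ℕ) (x : ℕ →₀ ℤ) : Prop :=
  (∀ y : ℕ →₀ ℤ, sigmaD n y = sigmaD n x → etaLen u w x ≤ etaLen u w y) ∧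
  (Even n → ∀ y : ℕ →₀ ℤ, sigmaD n y = sigmaD n x → etaLen u w y = etaLen u w x → absLexLE x y)

def tWord (m : ℤ) : List Letter := List.replicate m.natAbs (1, decide (0 < m))

def aWord (m : ℤ) : List Letter := List.replicate m.natAbs (0, decide (0 < m))

def eta1Word (u w : ℕ) (x : ℕ →₀ ℤ) : List Letter :=
  tWord (-(u : ℤ)) ++ aWord (x 0) ++
    (((List.range (kIdx x)).map fun j => tWord 1 ++ aWord (x (j + 1))).flatten) ++
    tWord ((w : ℤ) - kIdx x)

def OnLang (n : ℕ) : Set (List Letter) :=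
  {wd | ∃ (u w : ℕ) (x : ℕ →₀ ℤ), x ≠ 0 ∧
    x ∈ BoxSet n u w (sigmaD n x) ∧ IsMinimalVec n u w x ∧ kIdx x < w ∧
    wd = eta1Word u w x}

theorem carry_ineq (α : ℤ) (hα : 1 ≤ α) (f0 c : ℤ) (h : |f0| ≤ α) :
    |f0| + |c| ≤ |f0 + (2 * α + 1) * c| := by
  by_cases hc : c = 0
  · subst hc; simp
  · have h1 : 1 ≤ |c| := Int.one_le_abs hc
    have h2 : |(2 * α + 1) * c| = (2 * α + 1) * |c| := by
      rw [abs_mul, abs_of_pos (by omega : (0:ℤ) < 2 * α + 1)]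
    have h3 : |(2 * α + 1) * c| ≤ |f0 + (2 * α + 1) * c| + |f0| := by
      have := abs_sub (f0 + (2 * α + 1) * c) f0
      simpa using this
    nlinarith

theorem l1_min (α : ℤ) (hα : 1 ≤ α) (M : ℕ) : ∀ (f g : ℕ → ℤ) (c : ℤ),
    (∀ i, |f i| ≤ α) →
    ∑ i ∈ Finset.range M, f i * (2 * α + 1) ^ i
      = c + ∑ i ∈ Finset.range M, g i * (2 * α + 1) ^ i →
    ∑ i ∈ Finset.range M, |f i| ≤ |c| + ∑ i ∈ Finset.range M, |g i| := by
  induction M with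
  | zero => intro f g c _ _; simp
  | succ M ih =>
    intro f g c hf h
    rw [Finset.sum_range_succ', Finset.sum_range_succ'] at h ⊢
    have e : ∀ f : ℕ → ℤ, ∑ i ∈ Finset.range M, f (i + 1) * (2 * α + 1) ^ (i + 1)
        = (2 * α + 1) * ∑ i ∈ Finset.range M, f (i + 1) * (2 * α + 1) ^ i := by
      intro f
      rw [Finset.mul_sum]
      exact Finset.sum_congr rfl fun i _ => by ring
    rw [e f, e g] at h
    set F := ∑ i ∈ Finset.range M, f (i + 1) * (2 * α + 1) ^ i with hF
    set G := ∑ i ∈ Finset.range M, g (i + 1) * (2 * α + 1) ^ i with hG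
    have h1 := ih (fun i => f (i + 1)) (fun i => g (i + 1)) (F - G) (fun i => hf _)
      (by simp only [← hF, ← hG]; ring)
    have h2 := carry_ineq α hα (f 0) (F - G) (hf 0)
    have h3 : f 0 + (2 * α + 1) * (F - G) = c + g 0 := by linear_combination h
    rw [h3] at h2
    have h4 := abs_add_le c (g 0)
    linarith

theorem supp_bound (x : ℕ →₀ ℤ) {M : ℕ} (h : kIdx x < M) : x.support ⊆ Finset.range M := by
  intro i hi
  have : i ≤ kIdx x := Finset.le_sup (f := id) hi
  simp; omega

theorem sigmaD_eq (n : ℕ) (x : ℕ →₀ ℤ) {M : ℕ} (h : kIdx x < M) :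
    sigmaD n x = ∑ i ∈ Finset.range M, x i * (n : ℤ) ^ i :=
  Finsupp.sum_of_support_subset _ (supp_bound x h) _ (by simp)

theorem l1D_eq (x : ℕ →₀ ℤ) {M : ℕ} (h : kIdx x < M) :
    (l1D x : ℤ) = ∑ i ∈ Finset.range M, |x i| := by
  have : l1D x = ∑ i ∈ Finset.range M, (x i).natAbs :=
    Finsupp.sum_of_support_subset _ (supp_bound x h) _ (by simp)
  rw [this]; push_cast; rfl

theorem zero_of_kIdx (x : ℕ →₀ ℤ) {i : ℕ} (h : kIdx x < i) : x i = 0 := by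
  by_contra h0
  have : i ≤ kIdx x := Finset.le_sup (f := id) (Finsupp.mem_support_iff.2 h0)
  omega

theorem etaLen_ge (u w : ℕ) (y : ℕ →₀ ℤ) : u + l1D y + w ≤ etaLen u w y := by
  unfold etaLen
  split_ifs <;> omega

theorem isMin_of_box (n α u w : ℕ) (hα : 1 ≤ α) (hn : n = 2 * α + 1) (x : ℕ →₀ ℤ)
    (hx : ∀ i, |x i| ≤ (α : ℤ)) (hk : kIdx x < w) : IsMinimalVec n u w x := by
  constructor
  · intro y hy
    have h1 : etaLen u w x = u + l1D x + w := by
      unfold etaLen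
      rw [if_pos (Or.inl hk.le)]
      omega
    have h2 := etaLen_ge u w y
    have hM1 : kIdx x < kIdx x + kIdx y + 1 := by omega
    have hM2 : kIdx y < kIdx x + kIdx y + 1 := by omega
    rw [sigmaD_eq n x hM1, sigmaD_eq n y hM2] at hy
    subst hn
    have h3 := l1_min α (by exact_mod_cast hα) (kIdx x + kIdx y + 1) x y 0 hx
      (by push_cast at hy; rw [zero_add]; exact hy.symm)
    rw [← l1D_eq x hM1, ← l1D_eq y hM2] at h3
    simp at h3
    omega
  · intro he
    exfalso
    rw [hn] at he
    exact (Nat.not_even_iff_odd.2 ⟨α, rfl⟩) he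

/-- concatenation of the blocks `a^{f j} t` for `j < w`. -/
def blk (w : ℕ) (f : ℕ → ℤ) : List Letter :=
  ((List.range w).map fun j => aWord (f j) ++ [((1 : Fin 2), true)]).flatten

theorem blk_succ (w : ℕ) (f : ℕ → ℤ) :
    blk (w + 1) f = blk w f ++ (aWord (f w) ++ [((1 : Fin 2), true)]) := by
  simp [blk, List.range_succ]

theorem blk_succ' (w : ℕ) (f : ℕ → ℤ) :
    blk (w + 1) f = aWord (f 0) ++ ((1 : Fin 2), true) :: blk w (fun j => f (j + 1)) := by
  simp [blk, List.range_succ_eq_map, Function.comp_def]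

theorem blk_congr (w : ℕ) (f g : ℕ → ℤ) (h : ∀ j < w, f j = g j) : blk w f = blk w g := by
  unfold blk
  congr 1
  apply List.map_congr_left
  intro j hj
  rw [h j (List.mem_range.1 hj)]

theorem tWord_one : tWord 1 = [((1 : Fin 2), true)] := by simp [tWord]

theorem blk_eq_aux (k : ℕ) (f : ℕ → ℤ) :
    aWord (f 0) ++ (((List.range k).map fun j => tWord 1 ++ aWord (f (j + 1))).flatten)
      ++ [((1 : Fin 2), true)] = blk (k + 1) f := by
  induction k with
  | zero => simp [blk]
  | succ k ih =>
    rw [blk_succ, ← ih]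
    simp [List.range_succ, tWord_one]

theorem blk_tail (k : ℕ) (f : ℕ → ℤ) (hf : ∀ i, k < i → f i = 0) (j : ℕ) :
    blk (k + 1 + j) f = blk (k + 1) f ++ List.replicate j ((1 : Fin 2), true) := by
  induction j with
  | zero => simp
  | succ j ih =>
    rw [← add_assoc, blk_succ, ih, hf _ (by omega), List.replicate_succ']
    simp [aWord]

theorem eta1_eq (u w : ℕ) (x : ℕ →₀ ℤ) (h : kIdx x < w) :
    eta1Word u w x = List.replicate u ((1 : Fin 2), false) ++ blk w x := by
  obtain ⟨j, rfl⟩ : ∃ j, w = kIdx x + 1 + j := ⟨w - kIdx x - 1, by omega⟩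
  rw [blk_tail _ _ (fun i hi => zero_of_kIdx x hi), ← blk_eq_aux]
  unfold eta1Word
  have h1 : tWord (-(u : ℤ)) = List.replicate u ((1 : Fin 2), false) := by
    have : ¬ ((0 : ℤ) < -(u : ℤ)) := by omega
    simp [tWord]
  have h2 : tWord (((kIdx x + 1 + j : ℕ) : ℤ) - kIdx x)
      = [((1 : Fin 2), true)] ++ List.replicate j ((1 : Fin 2), true) := by
    have e : (((kIdx x + 1 + j : ℕ) : ℤ) - kIdx x) = ((j + 1 : ℕ) : ℤ) := by push_cast; ring
    rw [e]
    have : ((0 : ℤ) < ((j + 1 : ℕ) : ℤ)) := by omega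
    unfold tWord
    rw [decide_eq_true this, Int.natAbs_natCast, List.replicate_succ]
    rfl
  rw [h1, h2]
  simp only [List.append_assoc]

/-- block words of length `m`. -/
noncomputable def EE (α : ℕ) : ℕ → Finset (List Letter)
  | 0 => {[]}
  | m + 1 => (Finset.Icc (-(α : ℤ)) α).biUnion fun d =>
      if d.natAbs ≤ m then
        (EE α (m - d.natAbs)).image fun l => aWord d ++ ((1 : Fin 2), true) :: l
      else ∅
termination_by m => m

theorem EE_succ (α m : ℕ) : EE α (m + 1) = (Finset.Icc (-(α : ℤ)) α).biUnion fun d =>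
      if d.natAbs ≤ m then
        (EE α (m - d.natAbs)).image fun l => aWord d ++ ((1 : Fin 2), true) :: l
      else ∅ := by rw [EE]

theorem mem_EE_succ (α m : ℕ) (wd : List Letter) : wd ∈ EE α (m + 1) ↔
    ∃ d : ℤ, |d| ≤ (α : ℤ) ∧ d.natAbs ≤ m ∧
      ∃ l ∈ EE α (m - d.natAbs), wd = aWord d ++ ((1 : Fin 2), true) :: l := by
  rw [EE_succ]
  simp only [Finset.mem_biUnion, Finset.mem_Icc, abs_le]
  constructor
  · rintro ⟨d, hd, h⟩
    split_ifs at h with h1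
    · obtain ⟨l, hl, rfl⟩ := Finset.mem_image.1 h
      exact ⟨d, hd, h1, l, hl, rfl⟩
    · simp at h
  · rintro ⟨d, hd, h1, l, hl, rfl⟩
    refine ⟨d, hd, ?_⟩
    rw [if_pos h1]
    exact Finset.mem_image_of_mem _ hl

theorem length_aWord (d : ℤ) : (aWord d).length = d.natAbs := by simp [aWord]

theorem EE_sound (α m : ℕ) : ∀ wd ∈ EE α m, wd.length = m ∧
    ∃ (w : ℕ) (f : ℕ → ℤ), (∀ j, |f j| ≤ (α : ℤ)) ∧ wd = blk w f := by
  induction m using Nat.strong_induction_on with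
  | _ m ih =>
    intro wd h
    match m, ih, h with
    | 0, _, h =>
      have : wd = [] := by simpa [EE] using h
      subst this
      exact ⟨rfl, 0, fun _ => 0, by simp, by simp [blk]⟩
    | m + 1, ih, h =>
      obtain ⟨d, hd, hm, l, hl, rfl⟩ := (mem_EE_succ _ _ _).1 h
      obtain ⟨h1, w, f, hf, rfl⟩ := ih (m - d.natAbs) (by omega) l hl
      refine ⟨?_, w + 1, fun j => Nat.casesOn j d f, ?_, ?_⟩
      · rw [List.length_append, List.length_cons, length_aWord, h1]; omega
      · intro j; cases j
        · exact hd
        · exact hf _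
      · rw [blk_succ']; rfl

theorem EE_complete (α w : ℕ) : ∀ (f : ℕ → ℤ), (∀ j < w, |f j| ≤ (α : ℤ)) →
    blk w f ∈ EE α (blk w f).length := by
  induction w with
  | zero => intro f _; simp [blk, EE]
  | succ w ih =>
    intro f hf
    have h1 := ih (fun j => f (j + 1)) (fun j hj => hf _ (by omega))
    have e : (blk (w + 1) f).length = ((f 0).natAbs + (blk w (fun j => f (j + 1))).length) + 1 := by
      rw [blk_succ', List.length_append, List.length_cons, length_aWord]; omega
    rw [e, mem_EE_succ]
    refine ⟨f 0, hf 0 (by omega), by omega, blk w (fun j => f (j + 1)), ?_, blk_succ' w f⟩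
    rw [Nat.add_sub_cancel_left]
    exact h1

theorem rep_inj (b b' : Bool) (l l' : List Letter) : ∀ (k k' : ℕ),
    List.replicate k ((0 : Fin 2), b) ++ ((1 : Fin 2), true) :: l
      = List.replicate k' ((0 : Fin 2), b') ++ ((1 : Fin 2), true) :: l' →
    k = k' ∧ (k ≠ 0 → b = b') ∧ l = l' := by
  intro k
  induction k with
  | zero =>
    intro k' h
    cases k' with
    | zero => simpa using h
    | succ k' => simp [List.replicate_succ] at h
  | succ k ih =>
    intro k' h
    cases k' with
    | zero => simp [List.replicate_succ] at h
    | succ k' =>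
      simp only [List.replicate_succ, List.cons_append, List.cons.injEq, Prod.mk.injEq,
        true_and] at h
      obtain ⟨h1, -, h3⟩ := ih k' h.2
      exact ⟨by omega, fun _ => h.1, h3⟩

theorem aWord_inj (d d' : ℤ) (l l' : List Letter)
    (h : aWord d ++ ((1 : Fin 2), true) :: l = aWord d' ++ ((1 : Fin 2), true) :: l') :
    d = d' ∧ l = l' := by
  obtain ⟨h1, h2, h3⟩ := rep_inj _ _ _ _ _ _ h
  refine ⟨?_, h3⟩
  by_cases h0 : d.natAbs = 0
  · omega
  · have := h2 h0
    rw [decide_eq_decide] at this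
    omega

theorem EE_card (α m : ℕ) : (EE α (m + 1)).card = ∑ d ∈ Finset.Icc (-(α : ℤ)) α,
    if d.natAbs ≤ m then (EE α (m - d.natAbs)).card else 0 := by
  rw [EE_succ, Finset.card_biUnion]
  · apply Finset.sum_congr rfl
    intro d _
    split_ifs
    · rw [Finset.card_image_of_injective]
      intro l l' h
      exact (aWord_inj _ _ _ _ h).2
    · rfl
  · intro d _ d' _ hne
    rw [Function.onFun, Finset.disjoint_left]
    intro wd h h'
    split_ifs at h h' <;> try simp at h h'
    obtain ⟨l, -, rfl⟩ := h
    obtain ⟨l', -, h'⟩ := h'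
    exact hne (aWord_inj _ _ _ _ h').1.symm

theorem root_sum (α : ℕ) (r : ℝ) : ∑ d ∈ Finset.Icc (-(α : ℤ)) α, r ^ (d.natAbs + 1)
    = r + ∑ i ∈ Finset.Icc 1 α, 2 * r ^ (i + 1) := by
  induction α with
  | zero => simp
  | succ α ih =>
    have e : Finset.Icc (-((α + 1 : ℕ) : ℤ)) ((α + 1 : ℕ) : ℤ)
        = insert (-((α + 1 : ℕ) : ℤ)) (insert ((α + 1 : ℕ) : ℤ) (Finset.Icc (-(α : ℤ)) α)) := by
      ext d
      simp only [Finset.mem_Icc, Finset.mem_insert]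
      omega
    rw [e, Finset.sum_insert, Finset.sum_insert, ih, Finset.sum_Icc_succ_top (by omega)]
    · simp only [Int.natAbs_neg, Int.natAbs_natCast]
      ring
    · simp
    · simp only [Finset.mem_Icc, Finset.mem_insert]
      omega

theorem EE_upper (α : ℕ) (r : ℝ) (hr0 : 0 < r)
    (hs : ∑ d ∈ Finset.Icc (-(α : ℤ)) α, r ^ (d.natAbs + 1) = 1) (m : ℕ) :
    ((EE α m).card : ℝ) * r ^ m ≤ 1 := by
  induction m using Nat.strong_induction_on with
  | _ m ih =>
    match m, ih with
    | 0, _ => simp [EE]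
    | m + 1, ih =>
      rw [EE_card, ← hs]
      push_cast
      rw [Finset.sum_mul]
      apply Finset.sum_le_sum
      intro d _
      split_ifs with h
      · have h1 := ih (m - d.natAbs) (by omega)
        have e : r ^ (m + 1) = r ^ (m - d.natAbs) * r ^ (d.natAbs + 1) := by
          rw [← pow_add]; congr 1; omega
        rw [e, ← mul_assoc]
        have : 0 < r ^ (d.natAbs + 1) := by positivity
        nlinarith
      · rw [zero_mul]; positivity

theorem EE_pos (α m : ℕ) : 1 ≤ (EE α m).card := by
  rw [Finset.one_le_card]
  induction m with
  | zero => simp [EE]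
  | succ m ih =>
    obtain ⟨l, hl⟩ := ih
    exact ⟨_, (mem_EE_succ _ _ _).2 ⟨0, by simp, by simp, l, by simpa using hl, rfl⟩⟩

theorem EE_lower (α : ℕ) (r : ℝ) (hr0 : 0 < r) (hr1 : r < 1)
    (hs : ∑ d ∈ Finset.Icc (-(α : ℤ)) α, r ^ (d.natAbs + 1) = 1) (m : ℕ) :
    r ^ α ≤ ((EE α m).card : ℝ) * r ^ m := by
  induction m using Nat.strong_induction_on with
  | _ m ih =>
    by_cases hm : m ≤ α
    · have h1 : (1 : ℝ) ≤ (EE α m).card := by exact_mod_cast EE_pos α m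
      have h2 : r ^ α ≤ r ^ m := pow_le_pow_of_le_one hr0.le hr1.le hm
      have h3 : 0 < r ^ m := by positivity
      nlinarith
    · match m, ih, hm with
      | 0, _, hm => omega
      | m + 1, ih, hm =>
        rw [EE_card]
        push_cast
        rw [Finset.sum_mul, ← mul_one (r ^ α), ← hs, Finset.mul_sum]
        apply Finset.sum_le_sum
        intro d hd
        rw [Finset.mem_Icc] at hd
        have h : d.natAbs ≤ m := by omega
        rw [if_pos h]
        have h1 := ih (m - d.natAbs) (by omega)
        have e : r ^ (m + 1) = r ^ (m - d.natAbs) * r ^ (d.natAbs + 1) := by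
          rw [← pow_add]; congr 1; omega
        rw [e, ← mul_assoc]
        exact mul_le_mul_of_nonneg_right h1 (by positivity)

/-- finite set containing all words of length `N`. -/
noncomputable def UU (α N : ℕ) : Finset (List Letter) :=
  (Finset.range (N + 1)).biUnion fun u =>
    (EE α (N - u)).image fun l => List.replicate u ((1 : Fin 2), false) ++ l

theorem OnLang_sub (n α N : ℕ) (hα : 1 ≤ α) (hn : n = 2 * α + 1) :
    OnLang n ∩ {wd : List Letter | wd.length = N} ⊆ (UU α N : Set (List Letter)) := by
  rintro wd ⟨⟨u, w, x, hx0, hbox, hmin, hk, rfl⟩, hlen⟩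
  simp only [Set.mem_ofPred_eq] at hlen
  rw [eta1_eq u w x hk] at hlen ⊢
  obtain ⟨-, hb1, hb2, -⟩ := hbox
  have hn2 : n / 2 = α := by omega
  rw [hn2] at hb1 hb2
  have hx : ∀ i, |x i| ≤ (α : ℤ) := by
    intro i
    rcases lt_trichotomy i (kIdx x) with h | h | h
    · exact hb1 i h
    · rw [h]; exact hb2 (lt_max_of_lt_right hk)
    · rw [zero_of_kIdx x h]; simp
  have h1 := EE_complete α w x (fun j _ => hx j)
  rw [List.length_append, List.length_replicate] at hlen
  unfold UU
  rw [Finset.mem_coe, Finset.mem_biUnion]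
  refine ⟨u, by rw [Finset.mem_range]; omega, Finset.mem_image.2 ⟨_, ?_, rfl⟩⟩
  have : N - u = (blk w x).length := by omega
  rw [this]
  exact h1

theorem OnLang_sup (n α m : ℕ) (hα : 1 ≤ α) (hn : n = 2 * α + 1) :
    (((EE α m).image fun l => aWord 1 ++ ((1 : Fin 2), true) :: l : Finset (List Letter)) :
      Set (List Letter)) ⊆ OnLang n ∩ {wd : List Letter | wd.length = m + 2} := by
  intro wd hwd
  rw [Finset.mem_coe, Finset.mem_image] at hwd
  obtain ⟨l, hl, rfl⟩ := hwd
  obtain ⟨hlen, w, f, hf, rfl⟩ := EE_sound α m l hl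
  refine ⟨?_, by simp [length_aWord, hlen]; omega⟩
  let g : ℕ → ℤ := fun j => if j < w + 1 then (Nat.casesOn j 1 f : ℤ) else 0
  have hg : ∀ j, |g j| ≤ (α : ℤ) := by
    intro j
    simp only [g]
    split_ifs
    · cases j
      · simp; omega
      · exact hf _
    · simp
  let x : ℕ →₀ ℤ := Finsupp.onFinset (Finset.range (w + 1)) g (by
    intro j hj
    by_contra h
    apply hj
    simp only [g]
    rw [if_neg (by simpa using h)])
  have hxg : ∀ j, x j = g j := fun j => rfl
  have hx0 : x 0 = 1 := by rw [hxg]; simp [g]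
  have hk : kIdx x < w + 1 := by
    unfold kIdx
    rw [Finset.sup_lt_iff (by simp)]
    intro j hj
    have := Finsupp.support_onFinset_subset hj
    simpa using this
  have hxb : ∀ j, |x j| ≤ (α : ℤ) := hg
  have hn2 : n / 2 = α := by omega
  refine ⟨0, w + 1, x, ?_, ⟨rfl, ?_, ?_, ?_⟩, isMin_of_box n α 0 (w + 1) hα hn x hxb hk, hk, ?_⟩
  · intro h
    rw [h] at hx0
    simp at hx0
  · intro i _; rw [hn2]; exact hxb i
  · intro _; rw [hn2]; exact hxb _
  · intro h
    exact absurd (lt_of_lt_of_le hk (le_trans (le_max_right _ _) h)) (lt_irrefl _)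
  · rw [eta1_eq 0 (w + 1) x hk, blk_succ', hx0]
    simp only [List.replicate_zero, List.nil_append]
    congr 2
    apply blk_congr
    intro j hj
    rw [hxg]
    simp [g, hj]

theorem growth_limit (r C : ℝ) (hr0 : 0 < r) (hC : 0 < C) (F : ℕ → ℝ)
    (hlo : ∀ N, 2 ≤ N → C ≤ F N * r ^ N) (hup : ∀ N, F N * r ^ N ≤ N + 1) :
    Tendsto (fun N : ℕ => F N ^ (1 / (N : ℝ))) atTop (𝓝 (1 / r)) := by
  have hinv : Tendsto (fun N : ℕ => 1 / (N : ℝ)) atTop (𝓝 0) := tendsto_one_div_atTop_nhds_zero_nat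
  have h1 : Tendsto (fun N : ℕ => C ^ (1 / (N : ℝ)) * (1 / r)) atTop (𝓝 (1 / r)) := by
    have := (tendsto_const_nhds (x := C)).rpow hinv (Or.inl hC.ne')
    simpa using this.mul_const (1 / r)
  have h2 : Tendsto (fun N : ℕ => ((N : ℝ) + 1) ^ (1 / (N : ℝ)) * (1 / r)) atTop (𝓝 (1 / r)) := by
    have h := (tendsto_rpow_div_mul_add 1 1 (-1) (by norm_num)).comp
      (tendsto_atTop_add_const_right atTop (1 : ℝ) tendsto_natCast_atTop_atTop)
    have h' : Tendsto (fun N : ℕ => ((N : ℝ) + 1) ^ (1 / (N : ℝ))) atTop (𝓝 1) := by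
      refine h.congr fun N => ?_
      simp [Function.comp]
    simpa using h'.mul_const (1 / r)
  have key : ∀ (N : ℕ) (a : ℝ), 2 ≤ N → 0 ≤ a →
      (a * (1 / r) ^ N) ^ (1 / (N : ℝ)) = a ^ (1 / (N : ℝ)) * (1 / r) := by
    intro N a hN ha
    rw [Real.mul_rpow ha (by positivity), one_div (N : ℝ),
      Real.pow_rpow_inv_natCast (by positivity) (by omega)]
  have hF : ∀ N, F N = (F N * r ^ N) * (1 / r) ^ N := by
    intro N
    rw [mul_assoc, ← mul_pow, mul_one_div_cancel hr0.ne', one_pow, mul_one]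
  refine tendsto_of_tendsto_of_tendsto_of_le_of_le' h1 h2 ?_ ?_
  · filter_upwards [eventually_ge_atTop 2] with N hN
    have hp := hlo N hN
    rw [hF N, key N _ hN (hC.le.trans hp)]
    gcongr
  · filter_upwards [eventually_ge_atTop 2] with N hN
    have hp := hlo N hN
    have hp2 := hup N
    have h0 := hC.le.trans hp
    rw [hF N, key N _ hN h0]
    gcongr

/-- For odd `n ≥ 3` with `α = (n-1)/2` and `r` the unique root in `(0,1)` of
`1 - x - ∑_{i=1}^α 2x^{i+1}`, the number of minimal strict shape 1 geodesics of length `N`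
satisfies `lim |O_n(N)|^{1/N} = 1/r`. -/
theorem shape1_growth_rate_odd (n α : ℕ) (hn : 3 ≤ n) (hodd : Odd n) (hα : α = (n - 1) / 2)
    (r : ℝ) (hr0 : 0 < r) (hr1 : r < 1)
    (hroot : 1 - r - ∑ i ∈ Finset.Icc 1 α, 2 * r ^ (i + 1) = 0) :
    Tendsto (fun N : ℕ => ((OnLang n ∩ {wd : List Letter | wd.length = N}).ncard : ℝ)
        ^ (1 / (N : ℝ)))
      atTop (𝓝 (1 / r)) := by
  have hα1 : 1 ≤ α := by omega
  have hn' : n = 2 * α + 1 := by obtain ⟨k, rfl⟩ := hodd; omega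
  have hs : ∑ d ∈ Finset.Icc (-(α : ℤ)) α, r ^ (d.natAbs + 1) = 1 := by
    rw [root_sum]; linarith
  refine growth_limit r (r ^ α * r ^ 2) hr0 (by positivity) _ ?_ ?_
  · intro N hN
    obtain ⟨m, rfl⟩ : ∃ m, N = m + 2 := ⟨N - 2, by omega⟩
    have hfin := (UU α (m + 2)).finite_toSet.subset (OnLang_sub n α (m + 2) hα1 hn')
    have h1 := Set.ncard_le_ncard (OnLang_sup n α m hα1 hn') hfin
    rw [Set.ncard_coe_finset, Finset.card_image_of_injective _
      (fun l l' h => (aWord_inj _ _ _ _ h).2)] at h1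
    have h2 := EE_lower α r hr0 hr1 hs m
    rw [pow_add, ← mul_assoc]
    have h3 : ((EE α m).card : ℝ)
      ≤ ((OnLang n ∩ {wd : List Letter | wd.length = m + 2}).ncard : ℝ) := by exact_mod_cast h1
    gcongr
    exact h2.trans (by gcongr)
  · intro N
    have h1 := Set.ncard_le_ncard (OnLang_sub n α N hα1 hn') (UU α N).finite_toSet
    rw [Set.ncard_coe_finset] at h1
    have h2 : (UU α N).card ≤ ∑ u ∈ Finset.range (N + 1), (EE α (N - u)).card :=
      Finset.card_biUnion_le.trans (Finset.sum_le_sum fun u _ => Finset.card_image_le)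
    have h3 : ((OnLang n ∩ {wd : List Letter | wd.length = N}).ncard : ℝ)
        ≤ ∑ u ∈ Finset.range (N + 1), ((EE α (N - u)).card : ℝ) := by
      exact_mod_cast h1.trans h2
    calc _ ≤ (∑ u ∈ Finset.range (N + 1), ((EE α (N - u)).card : ℝ)) * r ^ N := by gcongr
      _ = ∑ u ∈ Finset.range (N + 1), ((EE α (N - u)).card : ℝ) * r ^ N := Finset.sum_mul _ _ _
      _ ≤ ∑ u ∈ Finset.range (N + 1), (1 : ℝ) := by
        apply Finset.sum_le_sum
        intro u _
        refine le_trans ?_ (EE_upper α r hr0 hs (N - u))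
        exact mul_le_mul_of_nonneg_left
          (pow_le_pow_of_le_one hr0.le hr1.le (Nat.sub_le _ _)) (Nat.cast_nonneg _)
      _ = N + 1 := by rw [Finset.sum_const, Finset.card_range, nsmul_eq_mul, mul_one]; push_cast; rfl
end

section
/- Let M be a deterministic finite automaton over a finite alphabet Γ with finite state set S and start state s₀. Then limsup_{N→∞} (f_{s₀}(N))^{1/N} equals the maximum, over all states s reachable from s₀, of limsup_{N→∞} (f_s(N))^{1/N}; in particular the growth rate of the number of accepted words of length N equals the maximal growth rate among the strongly connected components of M reachable from the start state. -/
open Filter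

/-- The number of words of length `N` over `Γ` which, when read by `M` starting from
state `s`, end in an accept state. -/
noncomputable def acceptCount {Γ S : Type*} (M : DFA Γ S) (s : S) (N : ℕ) : ℕ :=
  Nat.card {w : List Γ // w.length = N ∧ M.evalFrom s w ∈ M.accept}

/-- `s'` is reachable from `s`: some (possibly empty) sequence of transitions leads
from `s` to `s'`. -/
def ReachableFrom {Γ S : Type*} (M : DFA Γ S) (s s' : S) : Prop :=
  ∃ w : List Γ, M.evalFrom s w = s'

lemma acceptCount_finite {Γ S : Type} [Fintype Γ] (M : DFA Γ S) (s : S) (N : ℕ) :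
    Finite {w : List Γ // w.length = N ∧ M.evalFrom s w ∈ M.accept} :=
  ((List.finite_length_eq Γ N).subset (fun _ h => h.1)).to_subtype

lemma acceptCount_le {Γ S : Type} [Fintype Γ] (M : DFA Γ S) (s : S) (N : ℕ) :
    acceptCount M s N ≤ Fintype.card Γ ^ N := by
  rw [← card_vector N, ← Nat.card_eq_fintype_card]
  exact Nat.card_le_card_of_injective
    (fun w => (⟨w.1, w.2.1⟩ : List.Vector Γ N))
    (fun a b h => Subtype.ext (congrArg List.Vector.toList h))

lemma acceptCount_shift {Γ S : Type} [Fintype Γ] (M : DFA Γ S) (s : S) (u : List Γ) (N : ℕ) :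
    acceptCount M (M.evalFrom s u) N ≤ acceptCount M s (N + u.length) := by
  have := acceptCount_finite M s (N + u.length)
  exact Nat.card_le_card_of_injective
    (fun w : {w : List Γ // w.length = N ∧ M.evalFrom (M.evalFrom s u) w ∈ M.accept} =>
      (⟨u ++ w.1, by simp [w.2.1, add_comm], by
        rw [DFA.evalFrom_of_append]; exact w.2.2⟩ :
        {w : List Γ // w.length = N + u.length ∧ M.evalFrom s w ∈ M.accept}))
    (fun a b h => Subtype.ext (List.append_cancel_left (congrArg Subtype.val h)))

lemma root_bdd {Γ S : Type} [Fintype Γ] (M : DFA Γ S) (s : S) :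
    IsBoundedUnder (· ≤ ·) atTop
      (fun N : ℕ => (acceptCount M s N : ℝ) ^ (1 / (N : ℝ))) := by
  refine isBoundedUnder_of_eventually_le (a := (Fintype.card Γ : ℝ)) ?_
  filter_upwards [eventually_gt_atTop 0] with N hN
  have h : (acceptCount M s N : ℝ) ≤ (Fintype.card Γ : ℝ) ^ N := by
    exact_mod_cast acceptCount_le M s N
  calc _ ≤ ((Fintype.card Γ : ℝ) ^ N) ^ (1 / (N : ℝ)) :=
        Real.rpow_le_rpow (by positivity) h (by positivity)
    _ = _ := by rw [one_div]; exact Real.pow_rpow_inv_natCast (by positivity) hN.ne'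

lemma root_cobdd {Γ S : Type} [Fintype Γ] (M : DFA Γ S) (s : S) :
    IsCoboundedUnder (· ≤ ·) atTop
      (fun N : ℕ => (acceptCount M s N : ℝ) ^ (1 / (N : ℝ))) :=
  isCoboundedUnder_le_of_le atTop (x := 0) (fun N => by positivity)

lemma limsup_le_of_reach {Γ S : Type} [Fintype Γ] (M : DFA Γ S) (s : S) (u : List Γ) :
    limsup (fun N : ℕ => (acceptCount M (M.evalFrom s u) N : ℝ) ^ (1 / (N : ℝ))) atTop ≤
      limsup (fun N : ℕ => (acceptCount M s N : ℝ) ^ (1 / (N : ℝ))) atTop := by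
  refine le_of_forall_gt_imp_ge_of_dense fun b hb => ?_
  have h1 := eventually_lt_of_limsup_lt hb (root_bdd M s)
  have hb0 : 0 < b := by
    obtain ⟨N, hN⟩ := h1.exists
    exact lt_of_le_of_lt (by positivity) hN
  have ht : Tendsto (fun N : ℕ => b * (b ^ u.length) ^ (1 / (N : ℝ))) atTop (nhds b) := by
    have h2 : Tendsto (fun N : ℕ => (b ^ u.length) ^ (1 / (N : ℝ))) atTop
        (nhds ((b ^ u.length) ^ (0 : ℝ))) :=
      (tendsto_const_nhds).rpow tendsto_one_div_atTop_nhds_zero_nat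
        (Or.inl (by positivity))
    simpa using h2.const_mul b
  rw [← ht.limsup_eq]
  refine limsup_le_limsup ?_ (root_cobdd M _) ht.isBoundedUnder_le
  filter_upwards [eventually_gt_atTop 0, (tendsto_add_atTop_nat u.length).eventually h1]
    with N hN hlt
  have hpos : N + u.length ≠ 0 := by omega
  have h3 : (acceptCount M s (N + u.length) : ℝ) ≤ b ^ (N + u.length) := by
    have := pow_le_pow_left₀ (by positivity) hlt.le (N + u.length)
    rwa [one_div, Real.rpow_inv_natCast_pow (by positivity) hpos] at this
  have h4 : (acceptCount M (M.evalFrom s u) N : ℝ) ≤ b ^ N * b ^ u.length := by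
    rw [← pow_add]
    exact le_trans (by exact_mod_cast acceptCount_shift M s u N) h3
  calc _ ≤ (b ^ N * b ^ u.length) ^ (1 / (N : ℝ)) :=
        Real.rpow_le_rpow (by positivity) h4 (by positivity)
    _ = _ := by
      rw [Real.mul_rpow (by positivity) (by positivity)]
      congr 1
      rw [one_div]; exact Real.pow_rpow_inv_natCast hb0.le hN.ne'

/-- The growth rate of the number of accepted words of a DFA equals the maximum of the
growth rates over the states reachable from the start state (hence the maximal growth
rate among the reachable strongly connected components). -/
theorem growth_rate_is_max_over_reachable {Γ S : Type} [Fintype Γ] [Fintype S]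
    (M : DFA Γ S) :
    limsup (fun N : ℕ => (acceptCount M M.start N : ℝ) ^ (1 / (N : ℝ))) atTop =
      sSup {L : ℝ | ∃ s : S, ReachableFrom M M.start s ∧
        L = limsup (fun N : ℕ => (acceptCount M s N : ℝ) ^ (1 / (N : ℝ))) atTop} := by
  symm
  refine IsGreatest.csSup_eq ⟨⟨M.start, ⟨[], rfl⟩, rfl⟩, ?_⟩
  rintro L ⟨s, ⟨u, rfl⟩, rfl⟩
  exact limsup_le_of_reach M M.start u
end
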